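/- arXiv:1808.04180 — 3 statements merged into one kernel-verified Lean document; each statement's English description precedes it below -/
import Mathlib

section
/- In the setting of the integral operators f_i with all exponents α_{ij} = 1, each f_i : 𝒞 → C_i is weakly multilinear, and its mode-wise Birkhoff contraction ratios satisfy κ_i(f_i) = 0 and, for every j ≠ i, κ_j(f_i) ≤ tanh( ¼ · log △_j(K) ), with the convention tanh(∞) = 1. -/
open MeasureTheory

/-- Extend a point of `∏_{j ≠ i} X j` to a point of `∏_j X j` by inserting `ξ` in slot `i`. -/
noncomputable def insertAt {ν : ℕ} (X : Fin ν → Type*) (i : Fin ν) (ξ : X i)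
    (ω : ∀ j : {j : Fin ν // j ≠ i}, X j.1) (j : Fin ν) : X j :=
  if h : j = i then cast (congrArg X h).symm ξ else ω ⟨j, h⟩

/-- The integral operator
`f_i(x)(ξ_i) = ∫_{Ω_i} K(ξ_1, …, ξ_ν) ∏_{j ≠ i} x_j(ξ_j) ∏_{j ≠ i} dη_j(ξ_j)`. -/
noncomputable def intOp {ν : ℕ} {X : Fin ν → Type*} [∀ j, TopologicalSpace (X j)]
    [∀ j, MeasurableSpace (X j)]
    (K : (∀ j, X j) → ℝ) (η : ∀ j, Measure (X j)) [∀ j, SigmaFinite (η j)] (i : Fin ν)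
    (x : ∀ j, C(X j, ℝ)) (ξ : X i) : ℝ :=
  ∫ ω : ∀ j : {j : Fin ν // j ≠ i}, X j.1,
    K (insertAt X i ξ ω) * ∏ j : {j : Fin ν // j ≠ i}, (x j.1) (ω j)
    ∂(Measure.pi fun j : {j : Fin ν // j ≠ i} => η j.1)

/-- The integral operator with real exponents
`f_i(x)(ξ_i) = ∫_{Ω_i} K(ξ_1, …, ξ_ν) ∏_{j ≠ i} x_j(ξ_j)^{α_j} ∏_{j ≠ i} dη_j(ξ_j)`. -/
noncomputable def intOpPow {ν : ℕ} {X : Fin ν → Type*} [∀ j, TopologicalSpace (X j)]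
    [∀ j, MeasurableSpace (X j)]
    (K : (∀ j, X j) → ℝ) (η : ∀ j, Measure (X j)) [∀ j, SigmaFinite (η j)]
    (α : Fin ν → ℝ) (i : Fin ν)
    (x : ∀ j, C(X j, ℝ)) (ξ : X i) : ℝ :=
  ∫ ω : ∀ j : {j : Fin ν // j ≠ i}, X j.1,
    K (insertAt X i ξ ω) * ∏ j : {j : Fin ν // j ≠ i}, Real.rpow ((x j.1) (ω j)) (α j.1)
    ∂(Measure.pi fun j : {j : Fin ν // j ≠ i} => η j.1)

/-- The mode-`j` kernel cross-ratio `△_j(K)`. -/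
noncomputable def crossRatio {ν : ℕ} {X : Fin ν → Type*} (K : (∀ j, X j) → ℝ) (j : Fin ν) : ℝ :=
  sSup {r : ℝ | ∃ ξ ξ' : ∀ l, X l,
    r = K ξ * K ξ' / (K (Function.update ξ j (ξ' j)) * K (Function.update ξ' j (ξ j)))}

/-- `M(x/y) = inf {β : x(ξ) ≤ β y(ξ) for all ξ}` for real-valued functions. -/
noncomputable def funM {X : Type*} (x y : X → ℝ) : ℝ :=
  sInf {β : ℝ | ∀ ξ, x ξ ≤ β * y ξ}

/-- The Hilbert projective metric `d(x,y) = log (M(x/y) M(y/x))` on the cone of nonnegative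
functions. -/
noncomputable def funD {X : Type*} (x y : X → ℝ) : ℝ :=
  Real.log (funM x y * funM y x)

/-- A map on a finite product of vector spaces is weakly multilinear if it coincides with a
multilinear map of a subcollection of its arguments. -/
def WeaklyMultilinear {ι : Type*} [Fintype ι] [DecidableEq ι] {V : ι → Type*}
    [∀ i, AddCommGroup (V i)] [∀ i, Module ℝ (V i)] {W : Type*} [AddCommGroup W] [Module ℝ W]
    (f : (∀ i, V i) → W) : Prop :=
  ∃ (s : Finset ι) (g : MultilinearMap ℝ (fun j : s => V j) W),
    ∀ x : ∀ i, V i, f x = g (fun j => x j)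

/-- Comparability of real-valued functions: `α g ≤ f ≤ β g` pointwise for some `α, β > 0`. -/
def funComp {X : Type*} (f g : X → ℝ) : Prop :=
  (∃ α : ℝ, 0 < α ∧ ∀ ξ, α * g ξ ≤ f ξ) ∧ (∃ β : ℝ, 0 < β ∧ ∀ ξ, f ξ ≤ β * g ξ)

/-- The projective diameter of a set of real-valued functions (possibly `+∞`). -/
noncomputable def funProjDiam {X : Type*} (S : Set (X → ℝ)) : EReal :=
  sSup {r : EReal | ∃ f ∈ S, ∃ g ∈ S, funComp f g ∧ r = ((funD f g : ℝ) : EReal)}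

/-- `tanh (t/4)` with the convention `tanh ∞ = 1`. -/
noncomputable def tanh4 (t : EReal) : ℝ :=
  if t = ⊤ then 1 else Real.tanh (t.toReal / 4)

/-- The mode-`j` Birkhoff contraction ratio of the integral operator `f_i`:
`κ_j(f_i) = sup_{z ∈ 𝒞} tanh (diam (f_i|_z^j (C_j); C_i) / 4)`. -/
noncomputable def intKappa {ν : ℕ} {X : Fin ν → Type*} [∀ l, TopologicalSpace (X l)]
    [∀ l, MeasurableSpace (X l)]
    (K : (∀ l, X l) → ℝ) (η : ∀ l, Measure (X l)) [∀ l, SigmaFinite (η l)]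
    (i j : Fin ν) : ℝ :=
  sSup {r : ℝ | ∃ z : ∀ l, C(X l, ℝ), (∀ l, ∀ ξ : X l, 0 ≤ z l ξ) ∧
    r = tanh4 (funProjDiam
      ((fun xj : C(X j, ℝ) => intOp K η i (Function.update z j xj)) ''
        {xj : C(X j, ℝ) | ∀ ξ, 0 ≤ xj ξ}))}

theorem aux_tanh_mono {a b : ℝ} (h : a ≤ b) : Real.tanh a ≤ Real.tanh b := by
  rw [Real.tanh_eq_sinh_div_cosh, Real.tanh_eq_sinh_div_cosh,
    div_le_div_iff₀ (Real.cosh_pos a) (Real.cosh_pos b)]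
  have h1 : 0 ≤ Real.sinh (b - a) := Real.sinh_nonneg_iff.2 (by linarith)
  rw [Real.sinh_sub] at h1
  linarith

/-- Continuous functions on a finite product of compact Hausdorff spaces are measurable for the
product σ-algebra (Stone-Weierstrass). -/
theorem aux_measurable {ι : Type*} {Y : ι → Type*} [∀ l, TopologicalSpace (Y l)]
    [∀ l, CompactSpace (Y l)] [∀ l, T2Space (Y l)] [∀ l, MeasurableSpace (Y l)]
    [∀ l, BorelSpace (Y l)] (F : (∀ l, Y l) → ℝ) (hF : Continuous F) : Measurable F := by
  let A : Subalgebra ℝ C(∀ l, Y l, ℝ) :=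
    { carrier := {f | Measurable f}
      mul_mem' := fun {a b} ha hb => by
        have ha' : Measurable a := ha
        have hb' : Measurable b := hb
        exact ha'.mul hb'
      add_mem' := fun {a b} ha hb => by
        have ha' : Measurable a := ha
        have hb' : Measurable b := hb
        exact ha'.add hb'
      algebraMap_mem' := fun r => by
        change Measurable (fun _ => _)
        exact measurable_const }
  have hA : A.SeparatesPoints := by
    intro x y hxy
    obtain ⟨l, hl⟩ := Function.ne_iff.1 hxy
    obtain ⟨f, hf0, hf1, -⟩ := exists_continuous_zero_one_of_isClosed
      (isClosed_singleton (x := x l)) (isClosed_singleton (x := y l))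
      (by simpa using hl)
    refine ⟨fun w => f (w l), ⟨⟨fun w => f (w l), by fun_prop⟩, ?_, rfl⟩, ?_⟩
    · change Measurable fun w : ∀ l, Y l => f (w l)
      exact f.continuous.measurable.comp (measurable_pi_apply l)
    · have h0 := hf0 (Set.mem_singleton _)
      have h1 := hf1 (Set.mem_singleton _)
      simp only [Pi.zero_apply, Pi.one_apply] at h0 h1
      simp [h0, h1]
  choose g hg using fun n : ℕ =>
    ContinuousMap.exists_mem_subalgebra_near_continuous_of_separatesPoints A hA F hF
      (1 / ((n : ℝ) + 1)) (by positivity)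
  refine measurable_of_tendsto_metrizable (f := fun n => ((g n : C(∀ l, Y l, ℝ)) : _ → ℝ))
    (fun n => (g n).2) ?_
  rw [tendsto_pi_nhds]
  intro x
  rw [tendsto_iff_norm_sub_tendsto_zero]
  exact squeeze_zero (fun _ => norm_nonneg _) (fun n => (hg n x).le)
    tendsto_one_div_add_atTop_nhds_zero_nat

theorem aux_integrable {ι : Type*} [Fintype ι] {Y : ι → Type*} [∀ l, TopologicalSpace (Y l)]
    [∀ l, CompactSpace (Y l)] [∀ l, T2Space (Y l)] [∀ l, MeasurableSpace (Y l)]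
    [∀ l, BorelSpace (Y l)] (μ : ∀ l, Measure (Y l)) [∀ l, IsFiniteMeasure (μ l)]
    (F : (∀ l, Y l) → ℝ) (hF : Continuous F) : Integrable F (Measure.pi μ) := by
  obtain ⟨C, hC⟩ := isCompact_univ.exists_bound_of_continuousOn hF.continuousOn
  exact Integrable.of_bound (aux_measurable F hF).aestronglyMeasurable C
    (Filter.Eventually.of_forall fun x => hC x (Set.mem_univ x))

/-- The key correlation inequality. -/
theorem aux_corr {A B : Type*} [MeasurableSpace A] [MeasurableSpace B]
    (μ : Measure A) (ρ : Measure B) [IsFiniteMeasure μ] [IsFiniteMeasure ρ]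
    (k₁ k₂ : A × B → ℝ) (x y : A → ℝ) (w : B → ℝ) (D : ℝ)
    (hx : ∀ a, 0 ≤ x a) (hy : ∀ a, 0 ≤ y a) (hw : ∀ b, 0 ≤ w b)
    (hk₁ : ∀ a, Integrable (fun b => k₁ (a, b) * w b) ρ)
    (hk₂ : ∀ a, Integrable (fun b => k₂ (a, b) * w b) ρ)
    (h₁x : Integrable (fun p : A × B => k₁ p * (x p.1 * w p.2)) (μ.prod ρ))
    (h₁y : Integrable (fun p : A × B => k₁ p * (y p.1 * w p.2)) (μ.prod ρ))
    (h₂x : Integrable (fun p : A × B => k₂ p * (x p.1 * w p.2)) (μ.prod ρ))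
    (h₂y : Integrable (fun p : A × B => k₂ p * (y p.1 * w p.2)) (μ.prod ρ))
    (hD : ∀ a b a' b', k₁ (a, b) * k₂ (a', b') ≤ D * (k₁ (a', b) * k₂ (a, b'))) :
    (∫ p, k₁ p * (x p.1 * w p.2) ∂(μ.prod ρ)) * (∫ p, k₂ p * (y p.1 * w p.2) ∂(μ.prod ρ)) ≤
    D * ((∫ p, k₂ p * (x p.1 * w p.2) ∂(μ.prod ρ)) *
      (∫ p, k₁ p * (y p.1 * w p.2) ∂(μ.prod ρ))) := by
  have key : ∀ (k : A × B → ℝ) (u : A → ℝ) (a : A),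
      ∫ b, k (a, b) * (u a * w b) ∂ρ = u a * ∫ b, k (a, b) * w b ∂ρ := by
    intro k u a
    rw [← integral_const_mul]
    congr 1; ext b; ring
  have e : ∀ (k : A × B → ℝ) (u : A → ℝ),
      Integrable (fun p : A × B => k p * (u p.1 * w p.2)) (μ.prod ρ) →
      ∫ p, k p * (u p.1 * w p.2) ∂(μ.prod ρ) = ∫ a, u a * ∫ b, k (a, b) * w b ∂ρ ∂μ := by
    intro k u h
    rw [integral_prod _ h]
    simp only [key]
  have ei : ∀ (k : A × B → ℝ) (u : A → ℝ),
      Integrable (fun p : A × B => k p * (u p.1 * w p.2)) (μ.prod ρ) →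
      Integrable (fun a => u a * ∫ b, k (a, b) * w b ∂ρ) μ := by
    intro k u h
    have := h.integral_prod_left
    simpa only [key] using this
  rw [e _ _ h₁x, e _ _ h₁y, e _ _ h₂x, e _ _ h₂y]
  have i1 := ei _ _ h₁x
  have i2 := ei _ _ h₁y
  have i3 := ei _ _ h₂x
  have i4 := ei _ _ h₂y
  have hA : ∀ a a', (∫ b, k₁ (a, b) * w b ∂ρ) * (∫ b, k₂ (a', b) * w b ∂ρ) ≤
      D * ((∫ b, k₁ (a', b) * w b ∂ρ) * (∫ b, k₂ (a, b) * w b ∂ρ)) := by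
    intro a a'
    rw [← integral_prod_mul, ← integral_prod_mul, ← integral_const_mul]
    refine integral_mono ((hk₁ a).mul_prod (hk₂ a')) (((hk₁ a').mul_prod (hk₂ a)).const_mul D) ?_
    rintro ⟨b, b'⟩
    have := mul_le_mul_of_nonneg_right (hD a b a' b') (mul_nonneg (hw b) (hw b'))
    simp only
    nlinarith
  generalize (fun a => ∫ b, k₁ (a, b) * w b ∂ρ) = A₁ at *
  rw [← integral_prod_mul, mul_comm (∫ a, x a * _ ∂μ) (∫ a, y a * _ ∂μ),
    mul_comm (∫ a, y a * _ ∂μ) (∫ a, x a * _ ∂μ), ← integral_prod_mul, ← integral_const_mul]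
  refine integral_mono (i1.mul_prod i4) ((i3.mul_prod i2).const_mul D) ?_
  rintro ⟨a, a'⟩
  have := mul_le_mul_of_nonneg_left (hA a a') (mul_nonneg (hx a) (hy a'))
  simp only
  nlinarith

theorem aux_funM_zero {Y : Type*} (f g : Y → ℝ) (hf : ∀ ξ, f ξ = 0) (hg : ∀ ξ, g ξ = 0) :
    funM f g = 0 := by
  unfold funM
  simp [hf, hg]

theorem aux_funM_pos {Y : Type*} (f g : Y → ℝ) (ξ₀ : Y) (hf : 0 < f ξ₀) (hg : 0 < g ξ₀)
    (hne : ∃ β : ℝ, ∀ ξ, f ξ ≤ β * g ξ) : 0 < funM f g := by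
  have : f ξ₀ / g ξ₀ ≤ funM f g := by
    refine le_csInf hne ?_
    intro β hβ
    rw [div_le_iff₀ hg]
    exact hβ ξ₀
  exact lt_of_lt_of_le (div_pos hf hg) this

theorem aux_funM_le {Y : Type*} (f g : Y → ℝ) (ξ₀ : Y) (hf : 0 < f ξ₀) (hg : 0 < g ξ₀)
    (β : ℝ) (hβ : ∀ ξ, f ξ ≤ β * g ξ) : funM f g ≤ β := by
  refine csInf_le ⟨0, ?_⟩ hβ
  intro b hb
  have := hb ξ₀
  by_contra hc
  push Not at hc
  nlinarith

theorem aux_funD_le {Y : Type*} (f g : Y → ℝ) (hf : ∀ ξ, 0 ≤ f ξ) (hg : ∀ ξ, 0 ≤ g ξ)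
    (hc : funComp f g) (D : ℝ) (hD : 1 ≤ D)
    (h : ∀ ξ ξ', f ξ * g ξ' ≤ D * (f ξ' * g ξ)) : funD f g ≤ Real.log D := by
  obtain ⟨⟨α, hα, hα'⟩, ⟨β, hβ, hβ'⟩⟩ := hc
  by_cases hz : ∀ ξ, g ξ = 0
  · have hz' : ∀ ξ, f ξ = 0 := fun ξ => le_antisymm (by simpa [hz] using hβ' ξ) (hf ξ)
    unfold funD
    rw [aux_funM_zero f g hz' hz]
    simpa using Real.log_nonneg hD
  · push Not at hz
    obtain ⟨ξ₀, h0⟩ := hz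
    have hg0 : 0 < g ξ₀ := lt_of_le_of_ne (hg _) (Ne.symm h0)
    have hf0 : 0 < f ξ₀ := lt_of_lt_of_le (mul_pos hα hg0) (hα' ξ₀)
    have hM : 0 < funM f g := aux_funM_pos f g ξ₀ hf0 hg0 ⟨β, hβ'⟩
    have hM' : 0 < funM g f := aux_funM_pos g f ξ₀ hg0 hf0
      ⟨α⁻¹, fun ξ => by rw [← div_eq_inv_mul, le_div_iff₀ hα]; linarith [hα' ξ]⟩
    have h1 : ∀ ξ', g ξ' ≤ D / funM f g * f ξ' := by
      intro ξ'
      rw [div_mul_eq_mul_div, le_div_iff₀ hM]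
      rcases (hg ξ').eq_or_lt with hh | hh
      · rw [← hh]; simp only [zero_mul]; exact mul_nonneg (by linarith) (hf ξ')
      · have : funM f g ≤ D * f ξ' / g ξ' := by
          refine aux_funM_le f g ξ₀ hf0 hg0 _ fun ξ => ?_
          rw [div_mul_eq_mul_div, le_div_iff₀ hh]
          linarith [h ξ ξ']
        rw [le_div_iff₀ hh] at this
        linarith
    have h2 := aux_funM_le g f ξ₀ hg0 hf0 _ h1
    unfold funD
    refine Real.log_le_log (mul_pos hM hM') ?_
    rw [le_div_iff₀ hM] at h2
    linarith

theorem aux_diam {Y : Type*} (S : Set (Y → ℝ)) (hS : ∀ f ∈ S, ∀ ξ, 0 ≤ f ξ) (hne : S.Nonempty)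
    (D : ℝ) (hD : 1 ≤ D)
    (h : ∀ f ∈ S, ∀ g ∈ S, ∀ ξ ξ', f ξ * g ξ' ≤ D * (f ξ' * g ξ)) :
    tanh4 (funProjDiam S) ≤ Real.tanh (Real.log D / 4) := by
  have h1 : funProjDiam S ≤ ((Real.log D : ℝ) : EReal) := by
    refine sSup_le ?_
    rintro r ⟨f, hf, g, hg, hc, rfl⟩
    exact_mod_cast aux_funD_le f g (hS f hf) (hS g hg) hc D hD (h f hf g hg)
  have h2 : funProjDiam S ≠ ⊤ := ne_top_of_le_ne_top (EReal.coe_ne_top _) h1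
  obtain ⟨f, hf⟩ := hne
  have h3 : ((funD f f : ℝ) : EReal) ≤ funProjDiam S :=
    le_sSup ⟨f, hf, f, hf, ⟨⟨1, one_pos, by simp⟩, ⟨1, one_pos, by simp⟩⟩, rfl⟩
  have h4 : funProjDiam S ≠ ⊥ := fun hb => by
    rw [hb] at h3; exact EReal.coe_ne_bot _ (le_bot_iff.1 h3)
  unfold tanh4
  rw [if_neg h2]
  apply aux_tanh_mono
  have : (funProjDiam S).toReal ≤ Real.log D := by
    have := EReal.toReal_le_toReal h1 h4 (EReal.coe_ne_top _)
    simpa using this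
  linarith

theorem aux_funD_self {Y : Type*} (f : Y → ℝ) (hf : ∀ ξ, 0 ≤ f ξ) : funD f f = 0 := by
  by_cases hz : ∀ ξ, f ξ = 0
  · unfold funD
    rw [aux_funM_zero f f hz hz]; simp
  · push Not at hz
    obtain ⟨ξ₀, h0⟩ := hz
    have h0 : 0 < f ξ₀ := lt_of_le_of_ne (hf _) (Ne.symm h0)
    have : funM f f = 1 := by
      refine le_antisymm (aux_funM_le f f ξ₀ h0 h0 1 (by simp)) ?_
      refine le_csInf ⟨1, by simp⟩ fun β hβ => ?_
      have := hβ ξ₀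
      by_contra hc
      push Not at hc
      nlinarith
    unfold funD
    rw [this]; simp

theorem aux_insertAt_continuous {ν : ℕ} {X : Fin ν → Type*} [∀ l, TopologicalSpace (X l)]
    (i : Fin ν) (ξ : X i) : Continuous (insertAt X i ξ) := by
  refine continuous_pi fun l => ?_
  unfold insertAt
  by_cases h : l = i
  · simp only [h, dite_true]
    exact continuous_const
  · simp only [h, dite_false]
    exact continuous_apply _

theorem aux_insertAt_swap {ν : ℕ} {X : Fin ν → Type*} [∀ l, TopologicalSpace (X l)]
    (i j : Fin ν) (hj : j ≠ i) (ξ ξ' : X i) (ω ω' ω'' : ∀ l : {l : Fin ν // l ≠ i}, X l.1)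
    (h1 : ω'' ⟨j, hj⟩ = ω' ⟨j, hj⟩) (h2 : ∀ l : {l : Fin ν // l ≠ i}, l.1 ≠ j → ω'' l = ω l) :
    Function.update (insertAt X i ξ ω) j (insertAt X i ξ' ω' j) = insertAt X i ξ ω'' := by
  funext l
  by_cases hl : l = j
  · subst hl
    simp [insertAt, hj, h1]
  · rw [Function.update_of_ne hl]
    by_cases hi : l = i
    · subst hi
      simp [insertAt]
    · simp [insertAt, hi, h2 ⟨l, hi⟩ hl]

theorem aux_cross {ν : ℕ} {X : Fin ν → Type*} [∀ l, TopologicalSpace (X l)]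
    [∀ l, CompactSpace (X l)] [∀ l, Nonempty (X l)]
    (K : (∀ l, X l) → ℝ) (hKc : Continuous K) (hKpos : ∀ ξ, 0 < K ξ) (j : Fin ν) :
    1 ≤ crossRatio K j ∧ ∀ ξ ξ' : ∀ l, X l, K ξ * K ξ' ≤ crossRatio K j *
      (K (Function.update ξ j (ξ' j)) * K (Function.update ξ' j (ξ j))) := by
  obtain ⟨p, -, hp⟩ := isCompact_univ.exists_isMinOn Set.univ_nonempty hKc.continuousOn
  obtain ⟨q, -, hq⟩ := isCompact_univ.exists_isMaxOn Set.univ_nonempty hKc.continuousOn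
  have hp' : ∀ ξ, K p ≤ K ξ := fun ξ => hp (Set.mem_univ ξ)
  have hq' : ∀ ξ, K ξ ≤ K q := fun ξ => hq (Set.mem_univ ξ)
  have hb : BddAbove {r : ℝ | ∃ ξ ξ' : ∀ l, X l,
      r = K ξ * K ξ' / (K (Function.update ξ j (ξ' j)) * K (Function.update ξ' j (ξ j)))} := by
    refine ⟨K q * K q / (K p * K p), ?_⟩
    rintro r ⟨ξ, ξ', rfl⟩
    have hp0 := hKpos p
    have hq0 := hKpos q
    exact div_le_div₀ (mul_pos hq0 hq0).le
      (mul_le_mul (hq' _) (hq' _) (hKpos _).le hq0.le) (mul_pos hp0 hp0)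
      (mul_le_mul (hp' _) (hp' _) hp0.le (hKpos _).le)
  have hle : ∀ ξ ξ' : ∀ l, X l, K ξ * K ξ' /
      (K (Function.update ξ j (ξ' j)) * K (Function.update ξ' j (ξ j))) ≤ crossRatio K j :=
    fun ξ ξ' => le_csSup hb ⟨ξ, ξ', rfl⟩
  constructor
  · have := hle p p
    simp only [Function.update_eq_self] at this
    rwa [div_self (mul_pos (hKpos p) (hKpos p)).ne'] at this
  · intro ξ ξ'
    have := hle ξ ξ'
    rwa [div_le_iff₀ (mul_pos (hKpos _) (hKpos _))] at this

theorem aux_intOp_corr {ν : ℕ} {X : Fin ν → Type*} [∀ l, TopologicalSpace (X l)]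
    [∀ l, CompactSpace (X l)]
    [∀ l, T2Space (X l)] [∀ l, Nonempty (X l)]
    [∀ l, MeasurableSpace (X l)] [∀ l, BorelSpace (X l)]
    (η : ∀ l, Measure (X l)) [∀ l, IsFiniteMeasure (η l)]
    (K : (∀ l, X l) → ℝ) (hKc : Continuous K) (hKpos : ∀ ξ, 0 < K ξ)
    (i j : Fin ν) (hj : j ≠ i) (z : ∀ l, C(X l, ℝ)) (hz : ∀ l, ∀ ξ : X l, 0 ≤ z l ξ)
    (x y : C(X j, ℝ)) (hx : ∀ ξ, 0 ≤ x ξ) (hy : ∀ ξ, 0 ≤ y ξ) (ξ ξ' : X i) :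
    intOp K η i (Function.update z j x) ξ * intOp K η i (Function.update z j y) ξ' ≤
    crossRatio K j *
      (intOp K η i (Function.update z j x) ξ' * intOp K η i (Function.update z j y) ξ) := by
  classical
  let p : {l : Fin ν // l ≠ i} → Prop := fun l => l.1 = j
  let e := MeasurableEquiv.piEquivPiSubtypeProd (fun l : {l : Fin ν // l ≠ i} => X l.1) p
  have he : MeasurePreserving e (Measure.pi fun l : {l : Fin ν // l ≠ i} => η l.1) _ :=
    measurePreserving_piEquivPiSubtypeProd (fun l : {l : Fin ν // l ≠ i} => η l.1) p
  have hec : Continuous e.symm :=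
    (Homeomorph.piEquivPiSubtypeProd p (fun l : {l : Fin ν // l ≠ i} => X l.1)).symm.continuous
  let u : C(X j, ℝ) → (∀ l : Subtype p, X l.1.1) → ℝ :=
    fun x a => ∏ l : Subtype p, (Function.update z j x l.1.1) (a l)
  let w : (∀ l : {l // ¬ p l}, X l.1.1) → ℝ := fun b => ∏ l : {l // ¬ p l}, (z l.1.1) (b l)
  let k : X i → _ → ℝ := fun ξ q => K (insertAt X i ξ (e.symm q))
  have hprod : ∀ (x : C(X j, ℝ)) (ω : ∀ l : {l : Fin ν // l ≠ i}, X l.1),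
      ∏ l : {l : Fin ν // l ≠ i}, (Function.update z j x l.1) (ω l) =
        u x (e ω).1 * w (e ω).2 := by
    intro x ω
    rw [← Fintype.prod_subtype_mul_prod_subtype p]
    congr 1
    refine Finset.prod_congr rfl fun l _ => ?_
    rw [Function.update_of_ne (show l.1.1 ≠ j from l.2)]
    rfl
  have hint : ∀ (x : C(X j, ℝ)) (ξ : X i), intOp K η i (Function.update z j x) ξ =
      ∫ q, k ξ q * (u x q.1 * w q.2) ∂((Measure.pi fun l : Subtype p => η l.1.1).prod
        (Measure.pi fun l : {l // ¬ p l} => η l.1.1)) := by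
    intro x ξ
    rw [← he.integral_comp e.measurableEmbedding]
    unfold intOp
    simp only [hprod, k, e.symm_apply_apply]
  have hkc : ∀ ξ, Continuous (k ξ) := fun ξ => hKc.comp ((aux_insertAt_continuous i ξ).comp hec)
  have huc : ∀ x, Continuous (u x) := fun x => by fun_prop
  have hwc : Continuous w := by fun_prop
  have hI : ∀ (x : C(X j, ℝ)) (ξ : X i), Integrable (fun q => k ξ q * (u x q.1 * w q.2))
      ((Measure.pi fun l : Subtype p => η l.1.1).prod
        (Measure.pi fun l : {l // ¬ p l} => η l.1.1)) := by
    intro x ξ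
    rw [← he.integrable_comp_emb e.measurableEmbedding]
    refine aux_integrable _ _ ?_
    have : Continuous e :=
      (Homeomorph.piEquivPiSubtypeProd p (fun l : {l : Fin ν // l ≠ i} => X l.1)).continuous
    have := hkc ξ
    have := huc x
    fun_prop
  have hup : ∀ x : C(X j, ℝ), (∀ ξ, 0 ≤ x ξ) → ∀ a, 0 ≤ u x a := by
    intro x hx a
    refine Finset.prod_nonneg fun l _ => ?_
    generalize a l = t
    have hl : l.1.1 = j := l.2
    revert t
    rw [hl]
    simpa using hx
  rw [hint, hint, hint, hint]
  refine aux_corr _ _ (k ξ) (k ξ') (u x) (u y) w (crossRatio K j) (hup x hx) (hup y hy)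
    (fun b => Finset.prod_nonneg fun l _ => hz _ _) ?_ ?_ (hI x ξ) (hI y ξ) (hI x ξ') (hI y ξ') ?_
  · intro a
    refine aux_integrable _ _ ?_
    have := hkc ξ
    fun_prop
  · intro a
    refine aux_integrable _ _ ?_
    have := hkc ξ'
    fun_prop
  · intro a b a' b'
    have hs : ∀ (a a' : ∀ l : Subtype p, X l.1.1) (b b' : ∀ l : {l // ¬ p l}, X l.1.1) (ξ ξ' : X i),
        Function.update (insertAt X i ξ (e.symm (a, b))) j
          (insertAt X i ξ' (e.symm (a', b')) j) = insertAt X i ξ (e.symm (a', b)) := by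
      intro a a' b b' ξ ξ'
      refine aux_insertAt_swap i j hj ξ ξ' _ _ _ ?_ ?_
      · have : p ⟨j, hj⟩ := rfl
        change (if h : p ⟨j, hj⟩ then _ else _) = (if h : p ⟨j, hj⟩ then _ else _)
        rw [dif_pos this, dif_pos this]
      · intro l hl
        have : ¬ p l := hl
        change (if h : p l then _ else _) = (if h : p l then _ else _)
        rw [dif_neg this, dif_neg this]
    have := (aux_cross K hKc hKpos j).2 (insertAt X i ξ (e.symm (a, b)))
      (insertAt X i ξ' (e.symm (a', b')))
    rw [hs, hs] at this
    exact this

theorem aux_intOp_nonneg {ν : ℕ} {X : Fin ν → Type*} [∀ l, TopologicalSpace (X l)]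
    [∀ l, MeasurableSpace (X l)]
    (η : ∀ l, Measure (X l)) [∀ l, SigmaFinite (η l)]
    (K : (∀ l, X l) → ℝ) (hKpos : ∀ ξ, 0 < K ξ)
    (i : Fin ν) (z : ∀ l, C(X l, ℝ)) (hz : ∀ l, ∀ ξ : X l, 0 ≤ z l ξ) (ξ : X i) :
    0 ≤ intOp K η i z ξ :=
  integral_nonneg fun _ => mul_nonneg (hKpos _).le (Finset.prod_nonneg fun _ _ => hz _ _)

theorem aux_update_nonneg {ν : ℕ} {X : Fin ν → Type*} [∀ l, TopologicalSpace (X l)]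
    (j : Fin ν) (z : ∀ l, C(X l, ℝ)) (hz : ∀ l, ∀ ξ : X l, 0 ≤ z l ξ)
    (x : C(X j, ℝ)) (hx : ∀ ξ, 0 ≤ x ξ) : ∀ l, ∀ ξ : X l, 0 ≤ Function.update z j x l ξ := by
  intro l
  by_cases h : l = j
  · subst h; simpa using hx
  · rw [Function.update_of_ne h]; exact hz l

theorem aux_weak {ν : ℕ} {X : Fin ν → Type*} [∀ l, TopologicalSpace (X l)]
    [∀ l, CompactSpace (X l)]
    [∀ l, T2Space (X l)]
    [∀ l, MeasurableSpace (X l)] [∀ l, BorelSpace (X l)]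
    (η : ∀ l, Measure (X l)) [∀ l, IsFiniteMeasure (η l)]
    (K : (∀ l, X l) → ℝ) (hKc : Continuous K) (i : Fin ν) :
    WeaklyMultilinear (fun x : ∀ l, C(X l, ℝ) => (fun ξ : X i => intOp K η i x ξ)) := by
  classical
  have hm : ∀ l : {l : Fin ν // l ≠ i}, l.1 ∈ Finset.univ.erase i := fun l => by simp [l.2]
  have hI : ∀ (x : ∀ l : (Finset.univ.erase i : Finset (Fin ν)), C(X l, ℝ)) (ξ : X i),
      Integrable (fun ω : ∀ l : {l : Fin ν // l ≠ i}, X l.1 => K (insertAt X i ξ ω) *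
        ∏ l : {l : Fin ν // l ≠ i}, (x ⟨l.1, hm l⟩) (ω l))
        (Measure.pi fun l : {l : Fin ν // l ≠ i} => η l.1) := by
    intro x ξ
    refine aux_integrable _ _ ?_
    have := aux_insertAt_continuous (X := X) i ξ
    fun_prop
  -- splitting the product at an index
  have hs : ∀ [DecidableEq (Finset.univ.erase i : Finset (Fin ν))]
      (x : ∀ l : (Finset.univ.erase i : Finset (Fin ν)), C(X l, ℝ))
      (m : (Finset.univ.erase i : Finset (Fin ν))) (c : C(X m, ℝ))
      (ω : ∀ l : {l : Fin ν // l ≠ i}, X l.1),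
      ∏ l : {l : Fin ν // l ≠ i}, (Function.update x m c ⟨l.1, hm l⟩) (ω l) =
      c (ω ⟨m.1, Finset.ne_of_mem_erase m.2⟩) *
        ∏ l ∈ Finset.univ.erase (⟨m.1, Finset.ne_of_mem_erase m.2⟩ : {l : Fin ν // l ≠ i}),
          (x ⟨l.1, hm l⟩) (ω l) := by
    intro inst x m c ω
    rw [← Finset.mul_prod_erase Finset.univ _
      (Finset.mem_univ (⟨m.1, Finset.ne_of_mem_erase m.2⟩ : {l : Fin ν // l ≠ i}))]
    congr 1
    · simp
    · refine Finset.prod_congr rfl fun l hl => ?_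
      rw [Function.update_of_ne]
      intro h
      apply Finset.ne_of_mem_erase hl
      ext
      rw [← h]
  refine ⟨Finset.univ.erase i,
    { toFun := fun x ξ => ∫ ω : ∀ l : {l : Fin ν // l ≠ i}, X l.1,
        K (insertAt X i ξ ω) * ∏ l : {l : Fin ν // l ≠ i}, (x ⟨l.1, hm l⟩) (ω l)
        ∂(Measure.pi fun l : {l : Fin ν // l ≠ i} => η l.1)
      map_update_add' := ?_
      map_update_smul' := ?_ }, ?_⟩
  · intro inst x m a b
    funext ξ
    simp only [Pi.add_apply]
    have h1 := hI (Function.update x m a) ξ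
    have h2 := hI (Function.update x m b) ξ
    rw [← integral_add h1 h2]
    congr 1
    funext ω
    rw [hs, hs, hs]
    simp only [ContinuousMap.add_apply]
    ring
  · intro inst x m c a
    funext ξ
    simp only [Pi.smul_apply, smul_eq_mul]
    rw [← integral_const_mul]
    congr 1
    funext ω
    rw [hs, hs]
    simp only [ContinuousMap.smul_apply, smul_eq_mul]
    ring
  · intro x
    rfl

/-- **Contraction ratios of positive integral operators**: each `f_i` is weakly multilinear,
`κ_i(f_i) = 0`, and `κ_j(f_i) ≤ tanh (¼ log △_j(K))` for `j ≠ i`. -/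
theorem integral_operator_contraction_ratios
    {ν : ℕ} {X : Fin ν → Type*} [∀ l, TopologicalSpace (X l)] [∀ l, CompactSpace (X l)]
    [∀ l, T2Space (X l)] [∀ l, Nonempty (X l)]
    [∀ l, MeasurableSpace (X l)] [∀ l, BorelSpace (X l)]
    (η : ∀ l, Measure (X l)) [∀ l, IsFiniteMeasure (η l)] [∀ l, (η l).Regular]
    [∀ l, (η l).IsOpenPosMeasure]
    (K : (∀ l, X l) → ℝ) (hKc : Continuous K) (hKpos : ∀ ξ, 0 < K ξ)
    (i : Fin ν) :
    WeaklyMultilinear (fun x : ∀ l, C(X l, ℝ) => (fun ξ : X i => intOp K η i x ξ)) ∧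
    intKappa K η i i = 0 ∧
    ∀ j : Fin ν, j ≠ i →
      intKappa K η i j ≤ Real.tanh (Real.log (crossRatio K j) / 4) := by
  refine ⟨aux_weak η K hKc i, ?_, ?_⟩
  · unfold intKappa
    have : {r : ℝ | ∃ z : ∀ l, C(X l, ℝ), (∀ l, ∀ ξ : X l, 0 ≤ z l ξ) ∧
        r = tanh4 (funProjDiam
        ((fun xj : C(X i, ℝ) => intOp K η i (Function.update z i xj)) ''
        {xj : C(X i, ℝ) | ∀ ξ, 0 ≤ xj ξ}))} = {0} := by
      have hval : ∀ z : ∀ l, C(X l, ℝ), (∀ l, ∀ ξ : X l, 0 ≤ z l ξ) →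
          tanh4 (funProjDiam
          ((fun xj : C(X i, ℝ) => intOp K η i (Function.update z i xj)) ''
          {xj : C(X i, ℝ) | ∀ ξ, 0 ≤ xj ξ})) = 0 := by
        intro z hz
        have h1 : (fun xj : C(X i, ℝ) => intOp K η i (Function.update z i xj)) ''
            {xj : C(X i, ℝ) | ∀ ξ, 0 ≤ xj ξ} = {intOp K η i z} := by
          have hc : ∀ xj : C(X i, ℝ),
              intOp K η i (Function.update z i xj) = intOp K η i z := by
            intro xj
            funext ξ
            unfold intOp
            congr 1
            funext ω
            congr 1
            refine Finset.prod_congr rfl fun l _ => ?_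
            rw [Function.update_of_ne l.2]
          simp only [hc]
          exact Set.Nonempty.image_const ⟨0, by simp⟩ _
        rw [h1]
        have h2 : funProjDiam {intOp K η i z} = 0 := by
          unfold funProjDiam
          have : {r : EReal | ∃ f ∈ ({intOp K η i z} : Set (X i → ℝ)),
              ∃ g ∈ ({intOp K η i z} : Set (X i → ℝ)), funComp f g ∧
              r = ((funD f g : ℝ) : EReal)} = {0} := by
            have hd := aux_funD_self _ (aux_intOp_nonneg η K hKpos i z hz)
            ext r
            simp only [Set.mem_singleton_iff, exists_eq_left, Set.mem_ofPred_eq, hd,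
              EReal.coe_zero, and_iff_right_iff_imp]
            rintro -
            exact ⟨⟨1, one_pos, by simp⟩, ⟨1, one_pos, by simp⟩⟩
          rw [this, sSup_singleton]
        rw [h2]
        simp [tanh4]
      ext r
      simp only [Set.mem_ofPred_eq, Set.mem_singleton_iff]
      constructor
      · rintro ⟨z, hz, rfl⟩
        exact hval z hz
      · rintro rfl
        exact ⟨fun _ => 0, by simp, (hval _ (by simp)).symm⟩
    rw [this, csSup_singleton]
  · intro j hj
    unfold intKappa
    refine csSup_le (Exists.intro _ ⟨fun _ => 0, by simp, rfl⟩) ?_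
    rintro r ⟨z, hz, rfl⟩
    refine aux_diam _ ?_ (Set.Nonempty.image _ ⟨0, by simp⟩) _ (aux_cross K hKc hKpos j).1 ?_
    · rintro _ ⟨x, hx, rfl⟩ ξ
      exact aux_intOp_nonneg η K hKpos i _ (aux_update_nonneg j z hz x hx) ξ
    · rintro _ ⟨x, hx, rfl⟩ _ ⟨y, hy, rfl⟩ ξ ξ'
      exact aux_intOp_corr η K hKc hKpos i j hj z hz x y hx hy ξ ξ'
end

section
/- In the setting of the integral operators f_i with arbitrary real exponents α_{ij}, acting on the cone of positive continuous functions: for all x, y ∈ 𝒞̊ and every i = 1, …, ν, d_{C_i}( f_i(x), f_i(y) ) ≤ Σ_{j=1}^ν A_{ij} · d_{C_j}(x_j, y_j), where A_{ii} = 0 and A_{ij} = |α_{ij}| · tanh( ¼ · log △_j(K) ) for j ≠ i. -/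
open MeasureTheory

lemma aux_alg {p q d s : ℝ} (hp : 0 ≤ p) (hq : 0 ≤ q) (hpd : p ≤ d) (hqd : q ≤ d) (hs : 1 ≤ s)
    (h : p * (d - q) ≤ s ^ 2 * (q * (d - p))) : p - q ≤ (s - 1) / (s + 1) * d := by
  rcases eq_or_lt_of_le (hp.trans hpd) with hd | hd
  · have : p = 0 := by linarith
    have : q = 0 := by linarith
    subst hd; simp_all
  have hD : 0 < d + (s ^ 2 - 1) * q := by nlinarith [mul_nonneg (sub_nonneg.2 hs) hq, mul_nonneg (mul_nonneg (sub_nonneg.2 hs) hq) (by linarith : (0:ℝ) ≤ s + 1)]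
  rw [div_mul_eq_mul_div, le_div_iff₀ (by linarith)]
  refine le_of_mul_le_mul_right ?_ hD
  have h1 : p * (d + (s ^ 2 - 1) * q) ≤ s ^ 2 * q * d := by nlinarith
  have h2 := mul_le_mul_of_nonneg_left h1 (by linarith : (0:ℝ) ≤ s + 1)
  have h3 := mul_nonneg (sub_nonneg.2 hs) (sq_nonneg (d - (s + 1) * q))
  nlinarith

lemma aux_tanh {D : ℝ} (hD : 1 ≤ D) :
    Real.tanh (Real.log D / 4) = (Real.sqrt D - 1) / (Real.sqrt D + 1) := by
  have h0 : 0 < D := by linarith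
  have hs : Real.sqrt D = Real.exp (Real.log D / 4) * Real.exp (Real.log D / 4) := by
    rw [← Real.exp_add, Real.sqrt_eq_rpow, Real.rpow_def_of_pos h0]; congr 1; ring
  rw [Real.tanh_eq_sinh_div_cosh, Real.sinh_eq, Real.cosh_eq, Real.exp_neg, hs]
  have := Real.exp_pos (Real.log D / 4)
  field_simp

section abs
variable {ι : Type*} [Fintype ι] {Y : ι → Type*} [∀ l, TopologicalSpace (Y l)]
  [∀ l, CompactSpace (Y l)] [∀ l, T2Space (Y l)] [∀ l, Nonempty (Y l)]
  [∀ l, MeasurableSpace (Y l)] [∀ l, BorelSpace (Y l)]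

/-- continuous functions on a product of compact spaces are measurable for the product algebra -/
lemma aux_meas {f : (∀ l, Y l) → ℝ} (hf : Continuous f) : Measurable f := by
  let S : Set C(∀ l, Y l, ℝ) := {F | ∃ (l : ι) (u : C(Y l, ℝ)), ∀ ω, F ω = u (ω l)}
  have hsep : (Algebra.adjoin ℝ S).SeparatesPoints := by
    intro a b hab
    obtain ⟨l, hl⟩ := Function.ne_iff.1 hab
    obtain ⟨u, hu0, hu1, -⟩ := exists_continuous_zero_one_of_isClosed
      (isClosed_singleton (x := a l)) (isClosed_singleton (x := b l)) (by simpa using hl)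
    let F : C(∀ l, Y l, ℝ) := ⟨fun ω => u (ω l), by fun_prop⟩
    refine ⟨F, ⟨F, Algebra.subset_adjoin ⟨l, u, fun _ => rfl⟩, rfl⟩, ?_⟩
    have h0 : u (a l) = 0 := hu0 rfl
    have h1 : u (b l) = 1 := hu1 rfl
    simp [F, h0, h1]
  have htop := ContinuousMap.subalgebra_topologicalClosure_eq_top_of_separatesPoints _ hsep
  have hA : ∀ F ∈ Algebra.adjoin ℝ S, Measurable (F : (∀ l, Y l) → ℝ) := by
    intro F hF
    induction hF using Algebra.adjoin_induction with
    | mem F hF =>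
      obtain ⟨l, u, h⟩ := hF
      have : (F : (∀ l, Y l) → ℝ) = fun ω => u (ω l) := funext h
      rw [this]
      exact u.continuous.measurable.comp (measurable_pi_apply l)
    | algebraMap r => exact measurable_const
    | add a b _ _ ha hb => exact ha.add hb
    | mul a b _ _ ha hb => exact ha.mul hb
  have hmem : (⟨f, hf⟩ : C(∀ l, Y l, ℝ)) ∈ closure (Algebra.adjoin ℝ S : Set C(∀ l, Y l, ℝ)) := by
    rw [← Subalgebra.topologicalClosure_coe, htop]; trivial
  obtain ⟨u, hu, hlim⟩ := mem_closure_iff_seq_limit.1 hmem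
  refine measurable_of_tendsto_metrizable (f := fun n => (u n : (∀ l, Y l) → ℝ))
    (fun n => hA _ (hu n)) ?_
  rw [tendsto_pi_nhds]
  intro ω
  exact ((continuous_eval_const ω).tendsto _).comp hlim

lemma aux_int (μ : ∀ l, Measure (Y l)) [∀ l, IsFiniteMeasure (μ l)]
    {f : (∀ l, Y l) → ℝ} (hf : Continuous f) : Integrable f (Measure.pi μ) := by
  obtain ⟨C, hC⟩ := isCompact_univ.exists_bound_of_continuousOn hf.continuousOn
  exact Integrable.of_bound (aux_meas hf).aestronglyMeasurable C
    (Filter.Eventually.of_forall fun ω => hC ω trivial)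

lemma aux_pos (μ : ∀ l, Measure (Y l)) [∀ l, IsFiniteMeasure (μ l)] [∀ l, (μ l).IsOpenPosMeasure]
    {f : (∀ l, Y l) → ℝ} (hf : Continuous f) (hp : ∀ ω, 0 < f ω) :
    0 < ∫ ω, f ω ∂(Measure.pi μ) := by
  rw [integral_pos_iff_support_of_nonneg (fun ω => (hp ω).le) (aux_int μ hf)]
  have : Function.support f = Set.univ := by
    ext ω; simp [(hp ω).ne']
  rw [this, Measure.pi_univ, pos_iff_ne_zero, Finset.prod_ne_zero_iff]
  intro l _
  exact isOpen_univ.measure_ne_zero _ Set.univ_nonempty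

open Classical in
/-- swapping one coordinate -/
noncomputable def swp (j : ι) (z : (∀ l, Y l) × (∀ l, Y l)) : (∀ l, Y l) × (∀ l, Y l) :=
  (Function.update z.1 j (z.2 j), Function.update z.2 j (z.1 j))

lemma aux_swap (μ : ∀ l, Measure (Y l)) [∀ l, IsFiniteMeasure (μ l)] (j : ι) :
    MeasurePreserving (swp (Y := Y) j) ((Measure.pi μ).prod (Measure.pi μ))
      ((Measure.pi μ).prod (Measure.pi μ)) := by
  classical
  have hm : Measurable (swp (Y := Y) j) := by
    refine Measurable.prodMk ?_ ?_ <;> rw [measurable_pi_iff] <;> intro l <;>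
    · by_cases h : l = j
      · subst h; simp; fun_prop
      · simp [h]; fun_prop
  refine ⟨hm, ?_⟩
  symm
  refine Measure.prod_eq_generateFrom generateFrom_pi generateFrom_pi isPiSystem_pi isPiSystem_pi
    (Measure.FiniteSpanningSetsIn.pi fun l => (μ l).toFiniteSpanningSetsIn)
    (Measure.FiniteSpanningSetsIn.pi fun l => (μ l).toFiniteSpanningSetsIn) ?_
  rintro _ ⟨s, hs, rfl⟩ _ ⟨t, ht, rfl⟩
  have hs' : ∀ l, MeasurableSet (s l) := fun l => hs l trivial
  have ht' : ∀ l, MeasurableSet (t l) := fun l => ht l trivial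
  rw [Measure.map_apply hm ((MeasurableSet.univ_pi hs').prod (MeasurableSet.univ_pi ht'))]
  have : swp (Y := Y) j ⁻¹' (Set.univ.pi s ×ˢ Set.univ.pi t)
      = Set.univ.pi (Function.update s j (t j)) ×ˢ Set.univ.pi (Function.update t j (s j)) := by
    ext ⟨a, b⟩
    simp only [swp, Set.mem_preimage, Set.mem_prod, Set.mem_pi, Set.mem_univ, forall_true_left]
    constructor
    · rintro ⟨h1, h2⟩
      constructor <;> intro l <;> by_cases h : l = j
      · subst h; simpa using h2 l
      · simpa [h] using h1 l
      · subst h; simpa using h1 l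
      · simpa [h] using h2 l
    · rintro ⟨h1, h2⟩
      constructor <;> intro l <;> by_cases h : l = j
      · subst h; simpa using h2 l
      · simpa [h] using h1 l
      · subst h; simpa using h1 l
      · simpa [h] using h2 l
  rw [this, Measure.prod_prod]
  simp only [Measure.pi_pi]
  rw [← Finset.prod_mul_distrib, ← Finset.prod_mul_distrib]
  refine Finset.prod_congr rfl fun l _ => ?_
  by_cases h : l = j
  · subst h; simp [mul_comm]
  · simp [h]

open Classical in
lemma aux_birk (μ : ∀ l, Measure (Y l)) [∀ l, IsFiniteMeasure (μ l)]
    [∀ l, (μ l).IsOpenPosMeasure] {p q : (∀ l, Y l) → ℝ} (hp : Continuous p) (hq : Continuous q)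
    (hp0 : ∀ ω, 0 < p ω) (hq0 : ∀ ω, 0 < q ω) (j : ι) {D : ℝ} (hD : 1 ≤ D)
    (h : ∀ ω ω', p ω * q ω' ≤
      D * (p (Function.update ω j (ω' j)) * q (Function.update ω' j (ω j))))
    (g : C(Y j, ℝ)) {d : ℝ} (hd : ∀ s s', g s - g s' ≤ d) :
    (∫ ω, p ω * g (ω j) ∂(Measure.pi μ)) / (∫ ω, p ω ∂(Measure.pi μ))
      - (∫ ω, q ω * g (ω j) ∂(Measure.pi μ)) / (∫ ω, q ω ∂(Measure.pi μ))
      ≤ Real.tanh (Real.log D / 4) * d := by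
  obtain ⟨s0, -, hs0⟩ := isCompact_univ.exists_isMinOn Set.univ_nonempty g.continuous.continuousOn
  have hmin : ∀ s, g s0 ≤ g s := fun s => hs0 (Set.mem_univ s)
  set a := g s0 with ha
  have hu0 : ∀ s, 0 ≤ g s - a := fun s => sub_nonneg.2 (hmin s)
  have hu1 : ∀ s, 0 ≤ d - (g s - a) := fun s => sub_nonneg.2 (hd s s0)
  have hgc : Continuous fun ω : ∀ l, Y l => g (ω j) := by fun_prop
  have hP := aux_pos μ hp hp0
  have hQ := aux_pos μ hq hq0
  have key : ∀ r : (∀ l, Y l) → ℝ, Continuous r → (∀ ω, 0 < r ω) →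
      (∫ ω, r ω * (g (ω j) - a) ∂(Measure.pi μ))
        = (∫ ω, r ω * g (ω j) ∂(Measure.pi μ)) - a * ∫ ω, r ω ∂(Measure.pi μ) ∧
      (∫ ω, r ω * (d - (g (ω j) - a)) ∂(Measure.pi μ))
        = d * (∫ ω, r ω ∂(Measure.pi μ)) - ∫ ω, r ω * (g (ω j) - a) ∂(Measure.pi μ) ∧
      0 ≤ (∫ ω, r ω * (g (ω j) - a) ∂(Measure.pi μ)) ∧
      0 ≤ (∫ ω, r ω * (d - (g (ω j) - a)) ∂(Measure.pi μ)) := by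
    intro r hr hr0
    refine ⟨?_, ?_, integral_nonneg fun ω => mul_nonneg (hr0 ω).le (hu0 _),
      integral_nonneg fun ω => mul_nonneg (hr0 ω).le (hu1 _)⟩
    · rw [← integral_const_mul, ← integral_sub (aux_int μ (by fun_prop)) (aux_int μ (by fun_prop))]
      congr 1; ext ω; ring
    · rw [← integral_const_mul, ← integral_sub (aux_int μ (by fun_prop)) (aux_int μ (by fun_prop))]
      congr 1; ext ω; ring
  obtain ⟨p1, p2, p3, p4⟩ := key p hp hp0
  obtain ⟨q1, q2, q3, q4⟩ := key q hq hq0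
  have hI1 : Integrable (fun z : (∀ l, Y l) × (∀ l, Y l) =>
      (p z.1 * (g (z.1 j) - a)) * (q z.2 * (d - (g (z.2 j) - a))))
      ((Measure.pi μ).prod (Measure.pi μ)) :=
    Integrable.mul_prod (f := fun ω => p ω * (g (ω j) - a))
      (g := fun ω => q ω * (d - (g (ω j) - a)))
      (aux_int μ (by fun_prop)) (aux_int μ (by fun_prop))
  have hI2 : Integrable (fun z : (∀ l, Y l) × (∀ l, Y l) =>
      (p z.1 * (d - (g (z.1 j) - a))) * (q z.2 * (g (z.2 j) - a)))
      ((Measure.pi μ).prod (Measure.pi μ)) :=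
    Integrable.mul_prod (g := fun ω => q ω * (g (ω j) - a))
      (f := fun ω => p ω * (d - (g (ω j) - a)))
      (aux_int μ (by fun_prop)) (aux_int μ (by fun_prop))
  have hsw := aux_swap μ j
  have hI3 := (hsw.integrable_comp hI2.aestronglyMeasurable).2 hI2
  have hE : ∫ z, (p (swp j z).1 * (d - (g ((swp j z).1 j) - a)))
        * (q (swp j z).2 * (g ((swp j z).2 j) - a)) ∂((Measure.pi μ).prod (Measure.pi μ))
      = ∫ z : (∀ l, Y l) × (∀ l, Y l), (p z.1 * (d - (g (z.1 j) - a)))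
        * (q z.2 * (g (z.2 j) - a)) ∂((Measure.pi μ).prod (Measure.pi μ)) := by
    conv_rhs => rw [← hsw.map_eq]
    rw [integral_map hsw.measurable.aemeasurable]
    rw [hsw.map_eq]; exact hI2.aestronglyMeasurable
  have hmain : (∫ ω, p ω * (g (ω j) - a) ∂(Measure.pi μ))
      * (∫ ω, q ω * (d - (g (ω j) - a)) ∂(Measure.pi μ)) ≤
      D * ((∫ ω, p ω * (d - (g (ω j) - a)) ∂(Measure.pi μ))
        * (∫ ω, q ω * (g (ω j) - a) ∂(Measure.pi μ))) := by
    rw [← integral_prod_mul, ← integral_prod_mul, ← hE, ← integral_const_mul]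
    refine integral_mono hI1 (hI3.const_mul D) ?_
    rintro ⟨ω, ω'⟩
    simp only [swp, Function.comp, Function.update_self]
    have := mul_le_mul_of_nonneg_right (h ω ω') (mul_nonneg (hu0 (ω j)) (hu1 (ω' j)))
    linarith
  rw [p2, q2] at hmain
  rw [p2] at p4
  rw [q2] at q4
  rw [aux_tanh hD]
  set P := ∫ ω, p ω ∂(Measure.pi μ)
  set Q := ∫ ω, q ω ∂(Measure.pi μ)
  set A := ∫ ω, p ω * (g (ω j) - a) ∂(Measure.pi μ)
  set B := ∫ ω, q ω * (g (ω j) - a) ∂(Measure.pi μ)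
  have hA : ∫ ω, p ω * g (ω j) ∂(Measure.pi μ) = A + a * P := by linarith
  have hB : ∫ ω, q ω * g (ω j) ∂(Measure.pi μ) = B + a * Q := by linarith
  have := aux_alg (p := A / P) (q := B / Q) (d := d) (s := Real.sqrt D) (by positivity)
    (by positivity) (by rw [div_le_iff₀ hP]; linarith) (by rw [div_le_iff₀ hQ]; linarith)
    (by simpa using Real.sqrt_le_sqrt hD) (by
      rw [Real.sq_sqrt (by linarith)]
      have e1 : A / P * (d - B / Q) = A * (d * Q - B) / (P * Q) := by field_simp
      have e2 : D * (B / Q * (d - A / P)) = D * ((d * P - A) * B) / (P * Q) := by field_simp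
      rw [e1, e2]
      gcongr)
  rw [hA, hB]
  have e : (A + a * P) / P - (B + a * Q) / Q = A / P - B / Q := by field_simp; ring
  rw [e]; exact this

lemma aux_deriv (μ : ∀ l, Measure (Y l)) [∀ l, IsFiniteMeasure (μ l)]
    {w h : (∀ l, Y l) → ℝ} (hw : Continuous w) (hh : Continuous h) (t : ℝ) :
    HasDerivAt (fun t => ∫ ω, w ω * Real.exp (t * h ω) ∂(Measure.pi μ))
      (∫ ω, w ω * Real.exp (t * h ω) * h ω ∂(Measure.pi μ)) t := by
  refine (hasDerivAt_integral_of_dominated_loc_of_deriv_le (s := Metric.ball t 1)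
    (F := fun t ω => w ω * Real.exp (t * h ω))
    (F' := fun t ω => w ω * Real.exp (t * h ω) * h ω)
    (bound := fun ω => |w ω| * Real.exp ((|t| + 1) * |h ω|) * |h ω|)
    (Metric.ball_mem_nhds t one_pos) ?_ ?_ ?_ ?_ ?_ ?_).2
  · exact Filter.Eventually.of_forall fun s =>
      (aux_int μ (by fun_prop)).aestronglyMeasurable
  · exact aux_int μ (by fun_prop)
  · exact (aux_int μ (by fun_prop)).aestronglyMeasurable
  · refine Filter.Eventually.of_forall fun ω s hs => ?_
    rw [norm_mul, norm_mul, Real.norm_eq_abs, Real.norm_eq_abs, Real.norm_eq_abs, Real.abs_exp]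
    rw [Metric.mem_ball, Real.dist_eq] at hs
    have h1 := abs_sub_abs_le_abs_sub s t
    have h2 : s * h ω ≤ (|t| + 1) * |h ω| := by
      refine (le_abs_self _).trans ?_
      rw [abs_mul]
      exact mul_le_mul_of_nonneg_right (by linarith) (abs_nonneg _)
    gcongr
  · exact aux_int μ (by fun_prop)
  · refine Filter.Eventually.of_forall fun ω s _ => ?_
    have := ((hasDerivAt_id s).mul_const (h ω)).exp.const_mul (w ω)
    simpa [mul_assoc] using this

open Classical in
lemma aux_main (μ : ∀ l, Measure (Y l)) [∀ l, IsFiniteMeasure (μ l)]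
    [∀ l, (μ l).IsOpenPosMeasure] {k k' : (∀ l, Y l) → ℝ} (hk : Continuous k)
    (hk' : Continuous k') (hk0 : ∀ ω, 0 < k ω) (hk0' : ∀ ω, 0 < k' ω) (D : ι → ℝ)
    (hD : ∀ l, 1 ≤ D l)
    (h : ∀ j ω ω', k ω * k' ω' ≤
      D j * (k (Function.update ω j (ω' j)) * k' (Function.update ω' j (ω j))))
    (v g : ∀ l, C(Y l, ℝ)) (hv : ∀ l s, 0 < v l s) (d : ι → ℝ)
    (hd : ∀ l s s', g l s - g l s' ≤ d l) (Z Z' : ℝ → ℝ)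
    (hZ : ∀ t, Z t = ∫ ω, k ω * (∏ l, v l (ω l)) * Real.exp (t * ∑ l, g l (ω l)) ∂(Measure.pi μ))
    (hZ' : ∀ t, Z' t =
      ∫ ω, k' ω * (∏ l, v l (ω l)) * Real.exp (t * ∑ l, g l (ω l)) ∂(Measure.pi μ)) :
    (∀ t, 0 < Z t) ∧ (∀ t, 0 < Z' t) ∧
    (Real.log (Z 1) - Real.log (Z' 1)) - (Real.log (Z 0) - Real.log (Z' 0))
      ≤ ∑ l, Real.tanh (Real.log (D l) / 4) * d l := by
  have hprod : ∀ ω : ∀ l, Y l, 0 < ∏ l, v l (ω l) := fun ω => Finset.prod_pos fun l _ => hv l _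
  have hpc : Continuous fun ω : ∀ l, Y l => ∏ l, v l (ω l) := by fun_prop
  have hsc : Continuous fun ω : ∀ l, Y l => ∑ l, g l (ω l) := by fun_prop
  have pos : ∀ t, 0 < Z t := fun t => by
    rw [hZ]
    exact aux_pos μ (by fun_prop)
      fun ω => mul_pos (mul_pos (hk0 ω) (hprod ω)) (Real.exp_pos _)
  have pos' : ∀ t, 0 < Z' t := fun t => by
    rw [hZ']
    exact aux_pos μ (by fun_prop)
      fun ω => mul_pos (mul_pos (hk0' ω) (hprod ω)) (Real.exp_pos _)
  refine ⟨pos, pos', ?_⟩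
  have d1 : ∀ t, HasDerivAt Z _ t := fun t => by
    rw [funext hZ]
    exact aux_deriv μ (w := fun ω => k ω * (∏ l, v l (ω l))) (by fun_prop) hsc t
  have d2 : ∀ t, HasDerivAt Z' _ t := fun t => by
    rw [funext hZ']
    exact aux_deriv μ (w := fun ω => k' ω * (∏ l, v l (ω l))) (by fun_prop) hsc t
  have dF := fun t => ((d1 t).log (pos t).ne').sub ((d2 t).log (pos' t).ne')
  have hmv := image_sub_le_mul_sub_of_deriv_le (fun t => (dF t).differentiableAt)
    (C := ∑ l, Real.tanh (Real.log (D l) / 4) * d l) ?_ (zero_le_one' ℝ)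
  · simpa using hmv
  intro t
  rw [(dF t).deriv]
  have split : ∀ r : (∀ l, Y l) → ℝ, Continuous r →
      ∫ ω, r ω * ∑ l, g l (ω l) ∂(Measure.pi μ)
        = ∑ l, ∫ ω, r ω * g l (ω l) ∂(Measure.pi μ) := by
    intro r hr
    rw [← integral_finsetSum _ (fun l _ => aux_int μ (by fun_prop))]
    simp only [Finset.mul_sum]
  rw [split _ (by fun_prop), split _ (by fun_prop), Finset.sum_div, Finset.sum_div,
    ← Finset.sum_sub_distrib, hZ, hZ']
  refine Finset.sum_le_sum fun j _ => ?_
  refine aux_birk μ (by fun_prop) (by fun_prop)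
    (fun ω => mul_pos (mul_pos (hk0 ω) (hprod ω)) (Real.exp_pos _))
    (fun ω => mul_pos (mul_pos (hk0' ω) (hprod ω)) (Real.exp_pos _)) j (hD j) ?_ (g j) (hd j)
  intro ω ω'
  have e1 : (∏ l, v l (ω l)) * (∏ l, v l (ω' l)) =
      (∏ l, v l (Function.update ω j (ω' j) l)) * (∏ l, v l (Function.update ω' j (ω j) l)) := by
    rw [← Finset.prod_mul_distrib, ← Finset.prod_mul_distrib]
    refine Finset.prod_congr rfl fun l _ => ?_
    by_cases hl : l = j
    · subst hl; simp [mul_comm]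
    · simp [hl]
  have e2 : (∑ l, g l (ω l)) + (∑ l, g l (ω' l)) =
      (∑ l, g l (Function.update ω j (ω' j) l)) + (∑ l, g l (Function.update ω' j (ω j) l)) := by
    rw [← Finset.sum_add_distrib, ← Finset.sum_add_distrib]
    refine Finset.sum_congr rfl fun l _ => ?_
    by_cases hl : l = j
    · subst hl; simp [add_comm]
    · simp [hl]
  have e3 : Real.exp (t * ∑ l, g l (ω l)) * Real.exp (t * ∑ l, g l (ω' l)) =
      Real.exp (t * ∑ l, g l (Function.update ω j (ω' j) l))
        * Real.exp (t * ∑ l, g l (Function.update ω' j (ω j) l)) := by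
    rw [← Real.exp_add, ← Real.exp_add, ← mul_add, ← mul_add, e2]
  have hpos : 0 ≤ ((∏ l, v l (ω l)) * (∏ l, v l (ω' l))) *
    (Real.exp (t * ∑ l, g l (ω l)) * Real.exp (t * ∑ l, g l (ω' l))) :=
    mul_nonneg (mul_nonneg (hprod ω).le (hprod ω').le) (by positivity)
  have := mul_le_mul_of_nonneg_right (h j ω ω') hpos
  calc _ = _ := by ring
    _ ≤ _ := this
    _ = _ := by rw [e1, e3]; ring
end abs

lemma funM_pos {X : Type*} [Nonempty X] {x y : X → ℝ} (hx : ∀ s, 0 < x s) (hy : ∀ s, 0 < y s)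
    {C : ℝ} (hC : ∀ s, x s ≤ C * y s) : 0 < funM x y ∧ ∀ s, x s ≤ funM x y * y s := by
  have : ∀ s, x s / y s ≤ funM x y := fun s =>
    le_csInf ⟨C, hC⟩ fun b hb => by rw [div_le_iff₀ (hy s)]; exact hb s
  refine ⟨?_, fun s => by have := this s; rwa [div_le_iff₀ (hy s)] at this⟩
  obtain ⟨s⟩ := ‹Nonempty X›
  exact (div_pos (hx s) (hy s)).trans_le (this s)

lemma funM_le {X : Type*} [Nonempty X] {x y : X → ℝ} (hx : ∀ s, 0 < x s) (hy : ∀ s, 0 < y s)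
    {C : ℝ} (hC : ∀ s, x s ≤ C * y s) : funM x y ≤ C := by
  refine csInf_le ⟨0, fun b hb => ?_⟩ hC
  obtain ⟨s⟩ := ‹Nonempty X›
  have := (hx s).trans_le (hb s)
  exact (pos_of_mul_pos_left this (hy s).le).le

lemma funD_le {X : Type*} [Nonempty X] {x y : X → ℝ} (hx : ∀ s, 0 < x s) (hy : ∀ s, 0 < y s)
    {C : ℝ} (h : ∀ s s', (Real.log (x s) - Real.log (x s')) - (Real.log (y s) - Real.log (y s')) ≤ C) :
    funD x y ≤ C := by
  have h' : ∀ s s', x s * y s' ≤ Real.exp C * (x s' * y s) := by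
    intro s s'
    rw [← Real.log_le_log_iff (mul_pos (hx _) (hy _))
      (mul_pos (Real.exp_pos _) (mul_pos (hx _) (hy _))),
      Real.log_mul (hx _).ne' (hy _).ne', Real.log_mul (Real.exp_pos _).ne'
      (mul_pos (hx _) (hy _)).ne', Real.log_mul (hx _).ne' (hy _).ne', Real.log_exp]
    linarith [h s s']
  have b1 : ∀ s', ∀ s, x s ≤ (Real.exp C * (x s' / y s')) * y s := by
    intro s' s
    have := h' s s'
    rw [← le_div_iff₀ (hy s')] at this
    refine this.trans (le_of_eq ?_); ring
  obtain ⟨s0⟩ := id ‹Nonempty X›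
  obtain ⟨m0, -⟩ := funM_pos hx hy (b1 s0)
  have b2 : ∀ s, y s ≤ (Real.exp C / funM x y) * x s := by
    intro s
    have := funM_le hx hy (b1 s)
    rw [mul_div_assoc', le_div_iff₀ (hy s)] at this
    rw [div_mul_eq_mul_div, le_div_iff₀ m0]; linarith
  obtain ⟨m1, -⟩ := funM_pos hy hx b2
  have := funM_le hy hx b2
  rw [le_div_iff₀ m0] at this
  unfold funD
  rw [Real.log_le_iff_le_exp (mul_pos m0 m1)]; linarith

lemma le_funD {X : Type*} [Nonempty X] [TopologicalSpace X] [CompactSpace X] (x y : C(X, ℝ))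
    (hx : ∀ s, 0 < x s) (hy : ∀ s, 0 < y s) (s s' : X) :
    (Real.log (x s) - Real.log (y s)) - (Real.log (x s') - Real.log (y s')) ≤ funD x y := by
  have bd : ∀ x y : C(X, ℝ), (∀ s, 0 < x s) → (∀ s, 0 < y s) → ∃ C, ∀ s, x s ≤ C * y s := by
    intro x y hx hy
    obtain ⟨C, hC⟩ := isCompact_univ.exists_bound_of_continuousOn
      (f := fun s => x s / y s) (Continuous.div x.continuous y.continuous
        fun s => (hy s).ne').continuousOn
    exact ⟨C, fun s => by
      rw [← div_le_iff₀ (hy s)]; exact (le_abs_self _).trans (hC s trivial)⟩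
  obtain ⟨C, hC⟩ := bd x y hx hy
  obtain ⟨C', hC'⟩ := bd y x hy hx
  obtain ⟨m0, h0⟩ := funM_pos hx hy hC
  obtain ⟨m1, h1⟩ := funM_pos hy hx hC'
  have l0 := Real.log_le_log (hx s) (h0 s)
  have l1 := Real.log_le_log (hy s') (h1 s')
  rw [Real.log_mul m0.ne' (hy _).ne'] at l0
  rw [Real.log_mul m1.ne' (hx _).ne'] at l1
  unfold funD
  rw [Real.log_mul m0.ne' m1.ne']
  linarith

lemma crossRatio_spec {ν : ℕ} {X : Fin ν → Type*} [∀ l, TopologicalSpace (X l)]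
    [∀ l, CompactSpace (X l)] [∀ l, Nonempty (X l)]
    (K : (∀ l, X l) → ℝ) (hKc : Continuous K) (hKpos : ∀ ξ, 0 < K ξ) (j : Fin ν) :
    1 ≤ crossRatio K j ∧ ∀ ξ ξ', K ξ * K ξ' ≤ crossRatio K j *
      (K (Function.update ξ j (ξ' j)) * K (Function.update ξ' j (ξ j))) := by
  have hb : BddAbove {r : ℝ | ∃ ξ ξ' : ∀ l, X l,
    r = K ξ * K ξ' / (K (Function.update ξ j (ξ' j)) * K (Function.update ξ' j (ξ j)))} := by
    have hc : Continuous fun z : (∀ l, X l) × (∀ l, X l) => K z.1 * K z.2 /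
        (K (Function.update z.1 j (z.2 j)) * K (Function.update z.2 j (z.1 j))) := by
      refine Continuous.div (by fun_prop) ?_ fun z => (mul_pos (hKpos _) (hKpos _)).ne'
      exact (hKc.comp (continuous_fst.update j ((continuous_apply j).comp continuous_snd))).mul
        (hKc.comp (continuous_snd.update j ((continuous_apply j).comp continuous_fst)))
    obtain ⟨C, hC⟩ := isCompact_univ.exists_bound_of_continuousOn hc.continuousOn
    refine ⟨C, ?_⟩
    rintro _ ⟨ξ, ξ', rfl⟩
    exact (le_abs_self _).trans (hC (ξ, ξ') trivial)
  constructor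
  · have ξ : ∀ l, X l := fun l => Classical.arbitrary _
    refine le_csSup hb ⟨ξ, ξ, ?_⟩
    simp [(hKpos ξ).ne']
  · intro ξ ξ'
    rw [← div_le_iff₀ (mul_pos (hKpos _) (hKpos _))]
    exact le_csSup hb ⟨ξ, ξ', rfl⟩

lemma insertAt_update {ν : ℕ} (X : Fin ν → Type*) (i : Fin ν) (ξ : X i)
    (ω : ∀ j : {j : Fin ν // j ≠ i}, X j.1) (j : {j : Fin ν // j ≠ i}) (s : X j.1) :
    insertAt X i ξ (Function.update ω j s) = Function.update (insertAt X i ξ ω) j.1 s := by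
  funext l
  by_cases hl : l = j.1
  · subst hl; simp [insertAt, j.2]
  · have : ∀ h : l ≠ i, (⟨l, h⟩ : {j : Fin ν // j ≠ i}) ≠ j := fun h e => hl (by rw [← e])
    rw [Function.update_of_ne hl]
    unfold insertAt
    split_ifs with h
    · rfl
    · rw [Function.update_of_ne (this h)]

lemma insertAt_cont {ν : ℕ} (X : Fin ν → Type*) [∀ l, TopologicalSpace (X l)] (i : Fin ν)
    (ξ : X i) : Continuous (insertAt X i ξ) := by
  refine continuous_pi fun l => ?_
  unfold insertAt
  by_cases h : l = i
  · simp only [h, dite_true]; exact continuous_const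
  · simp only [h, dite_false]; exact continuous_apply _

/-- **Lipschitz matrix of integral operators with exponents**: on the cone of positive continuous
functions, `d_{C_i}(f_i(x), f_i(y)) ≤ Σ_j A_{ij} d_{C_j}(x_j, y_j)` with `A_{ii} = 0` and
`A_{ij} = |α_{ij}| tanh (¼ log △_j(K))` for `j ≠ i`. -/
theorem integral_operator_lipschitz_matrix
    {ν : ℕ} {X : Fin ν → Type*} [∀ l, TopologicalSpace (X l)] [∀ l, CompactSpace (X l)]
    [∀ l, T2Space (X l)] [∀ l, Nonempty (X l)]
    [∀ l, MeasurableSpace (X l)] [∀ l, BorelSpace (X l)]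
    (η : ∀ l, Measure (X l)) [∀ l, IsFiniteMeasure (η l)] [∀ l, (η l).Regular]
    [∀ l, (η l).IsOpenPosMeasure]
    (K : (∀ l, X l) → ℝ) (hKc : Continuous K) (hKpos : ∀ ξ, 0 < K ξ)
    (α : Fin ν → Fin ν → ℝ) :
    ∀ x y : ∀ l, C(X l, ℝ), (∀ l, ∀ ξ : X l, 0 < x l ξ) → (∀ l, ∀ ξ : X l, 0 < y l ξ) →
      ∀ i, funD (intOpPow K η (α i) i x) (intOpPow K η (α i) i y)
        ≤ ∑ j, (if j = i then 0
            else |α i j| * Real.tanh (Real.log (crossRatio K j) / 4)) * funD (x j) (y j) := by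
  intro x y hx hy i
  have hne := fun l (s : X l) => (hx l s).ne'
  have hne' := fun l (s : X l) => (hy l s).ne'
  let v : ∀ l : {j : Fin ν // j ≠ i}, C(X l.1, ℝ) := fun l =>
    ⟨fun s => (y l.1 s) ^ (α i l.1), (y l.1).continuous.rpow_const fun s => Or.inl (hne' _ s)⟩
  let g : ∀ l : {j : Fin ν // j ≠ i}, C(X l.1, ℝ) := fun l =>
    ⟨fun s => α i l.1 * (Real.log (x l.1 s) - Real.log (y l.1 s)),
      continuous_const.mul (((x l.1).continuous.log (hne _)).sub ((y l.1).continuous.log (hne' _)))⟩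
  have hv : ∀ l s, 0 < v l s := fun l s => Real.rpow_pos_of_pos (hy _ _) _
  have hd : ∀ l s s', g l s - g l s' ≤ |α i l.1| * funD (x l.1) (y l.1) := by
    intro l s s'
    have h1 := le_funD (x l.1) (y l.1) (hx _) (hy _) s s'
    have h2 := le_funD (x l.1) (y l.1) (hx _) (hy _) s' s
    change α i l.1 * (_ - _) - α i l.1 * (_ - _) ≤ _
    rw [← mul_sub]
    refine (le_abs_self _).trans ?_
    rw [abs_mul]
    refine mul_le_mul_of_nonneg_left ?_ (abs_nonneg _)
    rw [abs_le]; constructor <;> linarith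
  let Z : X i → ℝ → ℝ := fun ξ t => ∫ ω : ∀ l : {j : Fin ν // j ≠ i}, X l.1,
    K (insertAt X i ξ ω) * (∏ l, v l (ω l)) * Real.exp (t * ∑ l, g l (ω l))
    ∂(Measure.pi fun l : {j : Fin ν // j ≠ i} => η l.1)
  have hZ0 : ∀ ξ, intOpPow K η (α i) i y ξ = Z ξ 0 := by
    intro ξ; simp [intOpPow, Z, v]
  have hZ1 : ∀ ξ, intOpPow K η (α i) i x ξ = Z ξ 1 := by
    intro ξ
    simp only [intOpPow, Z]
    congr 1; ext ω
    rw [one_mul, Real.exp_sum, mul_assoc, ← Finset.prod_mul_distrib]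
    congr 1
    refine Finset.prod_congr rfl fun l _ => ?_
    change (x l.1 (ω l)) ^ (α i l.1) = (y l.1 (ω l)) ^ (α i l.1) * Real.exp (_ * (_ - _))
    rw [Real.rpow_def_of_pos (hx _ _), Real.rpow_def_of_pos (hy _ _), ← Real.exp_add]
    congr 1; ring
  have main := fun ξ ξ' => aux_main (fun l : {j : Fin ν // j ≠ i} => η l.1)
    (hKc.comp (insertAt_cont X i ξ)) (hKc.comp (insertAt_cont X i ξ'))
    (fun ω => hKpos _) (fun ω => hKpos _) (fun l => crossRatio K l.1)
    (fun l => (crossRatio_spec K hKc hKpos l.1).1) (by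
      intro j ω ω'
      have := (crossRatio_spec K hKc hKpos j.1).2 (insertAt X i ξ ω) (insertAt X i ξ' ω')
      have e : ∀ (ξ : X i) (ω : ∀ l : {j : Fin ν // j ≠ i}, X l.1),
        insertAt X i ξ ω j.1 = ω j := fun ξ ω => by simp [insertAt, j.2]
      rw [e, e, ← insertAt_update, ← insertAt_update] at this
      simp only [Function.comp]
      convert this) v g hv _ hd (Z ξ) (Z ξ') (fun _ => rfl) (fun _ => rfl)
  have hsum : ∑ j, (if j = i then 0
        else |α i j| * Real.tanh (Real.log (crossRatio K j) / 4)) * funD (x j) (y j)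
      = ∑ l : {j : Fin ν // j ≠ i}, Real.tanh (Real.log (crossRatio K l.1) / 4) *
        (|α i l.1| * funD (x l.1) (y l.1)) := by
    rw [← Finset.sum_subtype (p := fun j => j ≠ i) (Finset.univ.filter (· ≠ i)) (by simp)
      (fun j => Real.tanh (Real.log (crossRatio K j) / 4) * (|α i j| * funD (x j) (y j))),
      Finset.sum_filter]
    refine Finset.sum_congr rfl fun j _ => ?_
    by_cases h : j = i
    · simp [h]
    · simp only [h, if_false, ne_eq, not_false_eq_true, if_true]; ring
  rw [hsum, funext hZ0, funext hZ1]
  refine funD_le (fun ξ => (main ξ ξ).1 1) (fun ξ => (main ξ ξ).1 0) fun ξ ξ' => ?_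
  exact (main ξ ξ').2.2
end

section
/- Let n ≥ 1 and ν ≥ 2 be integers and let H be the Hilbert tensor on {1, …, n}^ν, H(i_1, …, i_ν) = 1 / (i_1 + ⋯ + i_ν − ν + 1). Then for every mode j ∈ {1, …, ν}, the kernel cross-ratio satisfies △_j(H) = ( n²(ν − 1) + n(2 − ν) ) / ( nν − ν + 1 ), where △_j(H) is the maximum over all index tuples (i_1, …, i_ν), (i'_1, …, i'_ν) ∈ {1, …, n}^ν of [H(i_1, …, i_ν) · H(i'_1, …, i'_ν)] / [H(i_1, …, i'_j, …, i_ν) · H(i'_1, …, i_j, …, i'_ν)] (the j-th entries swapped in the denominator). -/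
/-- The Hilbert tensor on `{1, …, n}^ν` (indices encoded by `Fin n`, entry `k` standing for
the integer `k + 1`): `H(i_1, …, i_ν) = 1 / (i_1 + ⋯ + i_ν − ν + 1)`. -/
noncomputable def hilbertTensor (n ν : ℕ) (t : Fin ν → Fin n) : ℝ :=
  1 / ((∑ k, (((t k : ℕ) : ℝ) + 1)) - ν + 1)

/-- The mode-`j` kernel cross-ratio of a discrete kernel `K` on `{1, …, n}^ν`. -/
noncomputable def discreteCrossRatio {n ν : ℕ} (K : (Fin ν → Fin n) → ℝ) (j : Fin ν) : ℝ :=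
  sSup {r : ℝ | ∃ t t' : Fin ν → Fin n,
    r = K t * K t' / (K (Function.update t j (t' j)) * K (Function.update t' j (t j)))}

theorem ht_update (n ν : ℕ) (j : Fin ν) (t : Fin ν → Fin n) (c : Fin n) :
    hilbertTensor n ν (Function.update t j c)
      = 1 / (((c : ℕ) : ℝ) + (∑ k ∈ Finset.univ.erase j, ((t k : ℕ) : ℝ)) + 1) := by
  unfold hilbertTensor
  rw [Finset.sum_add_distrib, ← Finset.add_sum_erase _ _ (Finset.mem_univ j)]
  have h : ∑ k ∈ Finset.univ.erase j, ((Function.update t j c k : ℕ) : ℝ)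
      = ∑ k ∈ Finset.univ.erase j, ((t k : ℕ) : ℝ) := by
    refine Finset.sum_congr rfl fun k hk => ?_
    rw [Function.update_of_ne (Finset.ne_of_mem_erase hk)]
  rw [h, Function.update_self]
  simp

theorem ht_self (n ν : ℕ) (j : Fin ν) (t : Fin ν → Fin n) :
    hilbertTensor n ν t
      = 1 / (((t j : ℕ) : ℝ) + (∑ k ∈ Finset.univ.erase j, ((t k : ℕ) : ℝ)) + 1) := by
  rw [← ht_update, Function.update_eq_self]

theorem ht_half {p q m M E : ℝ} (hp : 0 ≤ p) (hq : 0 ≤ q) (hpm : p ≤ m) (hqM : q ≤ M)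
    (hE : 1 ≤ E) : p * q * (m + M + 1) ≤ m * M * ((p + q + 1) * E) := by
  have hm : 0 ≤ m := hp.trans hpm
  have hM : 0 ≤ M := hq.trans hqM
  have h1 : p * q ≤ m * M := mul_le_mul hpm hqM hq hm
  have h2 : (p * m) * q ≤ (p * m) * M := mul_le_mul_of_nonneg_left hqM (by positivity)
  have h3 : (q * M) * p ≤ (q * M) * m := mul_le_mul_of_nonneg_left hpm (by positivity)
  have h4 : 0 ≤ m * M * (p + q + 1) * (E - 1) :=
    mul_nonneg (by positivity) (by linarith)
  nlinarith

theorem ht_bound {x y s r m M : ℝ} (hx : 0 ≤ x) (hy : 0 ≤ y) (hs : 0 ≤ s) (hr : 0 ≤ r)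
    (hxm : x ≤ m) (hym : y ≤ m) (hsM : s ≤ M) (hrM : r ≤ M) :
    (y + s + 1) * (x + r + 1) * (m + M + 1)
      ≤ (m + 1) * (M + 1) * ((x + s + 1) * (y + r + 1)) := by
  have hm : 0 ≤ m := hx.trans hxm
  have hM : 0 ≤ M := hs.trans hsM
  have key : (y - x) * (r - s) * (m + M + 1) ≤ m * M * ((x + s + 1) * (y + r + 1)) := by
    have e1 := ht_half hy hr hym hrM (E := x + s + 1) (by linarith)
    have e2 := ht_half hx hs hxm hsM (E := y + r + 1) (by linarith)
    have hpos : 0 ≤ m + M + 1 := by linarith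
    have hR : 0 ≤ m * M * ((x + s + 1) * (y + r + 1)) := by positivity
    rcases le_total x y with h | h <;> rcases le_total s r with h' | h'
    · have : (y - x) * (r - s) ≤ y * r :=
        mul_le_mul (by linarith) (by linarith) (by linarith) hy
      have := mul_le_mul_of_nonneg_right this hpos
      linarith
    · have := mul_nonneg (mul_nonneg (sub_nonneg.2 h) (sub_nonneg.2 h')) hpos
      linarith
    · have := mul_nonneg (mul_nonneg (sub_nonneg.2 h) (sub_nonneg.2 h')) hpos
      linarith
    · have : (x - y) * (s - r) ≤ x * s :=
        mul_le_mul (by linarith) (by linarith) (by linarith) hx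
      have := mul_le_mul_of_nonneg_right this hpos
      linarith
  linarith

/-- **Cross-ratio of the Hilbert tensor**:
`△_j(H) = (n²(ν − 1) + n(2 − ν)) / (nν − ν + 1)` for every mode `j`. -/
theorem hilbert_tensor_cross_ratio (n ν : ℕ) (hn : 1 ≤ n) (hν : 2 ≤ ν) (j : Fin ν) :
    discreteCrossRatio (hilbertTensor n ν) j
      = ((n : ℝ) ^ 2 * ((ν : ℝ) - 1) + (n : ℝ) * (2 - (ν : ℝ)))
        / ((n : ℝ) * (ν : ℝ) - (ν : ℝ) + 1) := by
  have hn1 : (1 : ℝ) ≤ n := by exact_mod_cast hn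
  have hν1 : (2 : ℝ) ≤ ν := by exact_mod_cast hν
  have hcard : ((Finset.univ.erase j).card : ℝ) = (ν : ℝ) - 1 := by
    rw [Finset.card_erase_of_mem (Finset.mem_univ j), Finset.card_univ, Fintype.card_fin,
      Nat.cast_sub (by omega)]
    simp
  have hle : ∀ c : Fin n, ((c : ℕ) : ℝ) ≤ (n : ℝ) - 1 := by
    intro c
    have : (c : ℕ) + 1 ≤ n := c.2
    have : (((c : ℕ) + 1 : ℕ) : ℝ) ≤ n := by exact_mod_cast this
    push_cast at this
    linarith
  have hM : 0 ≤ ((ν : ℝ) - 1) * ((n : ℝ) - 1) :=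
    mul_nonneg (by linarith) (by linarith)
  have hrhs : ((n : ℝ) ^ 2 * ((ν : ℝ) - 1) + (n : ℝ) * (2 - (ν : ℝ)))
        / ((n : ℝ) * (ν : ℝ) - (ν : ℝ) + 1)
      = (((n : ℝ) - 1 + 1) * (((ν : ℝ) - 1) * ((n : ℝ) - 1) + 1))
        / (((n : ℝ) - 1) + ((ν : ℝ) - 1) * ((n : ℝ) - 1) + 1) := by
    congr 1 <;> ring
  rw [hrhs]
  unfold discreteCrossRatio
  refine IsGreatest.csSup_eq ⟨?_, ?_⟩
  · refine ⟨fun k => ⟨0, by omega⟩, fun k => ⟨n - 1, by omega⟩, ?_⟩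
    rw [ht_update, ht_update, ht_self n ν j, ht_self n ν j]
    simp only [Finset.sum_const, nsmul_eq_mul, hcard]
    rw [Nat.cast_sub hn]
    have : 0 < (n : ℝ) - 1 + ((ν : ℝ) - 1) * ((n : ℝ) - 1) + 1 := by linarith
    have : 0 < ((ν : ℝ) - 1) * ((n : ℝ) - 1) + 1 := by linarith
    simp
    field_simp
  · rintro _ ⟨t, t', rfl⟩
    rw [ht_update, ht_update, ht_self n ν j t, ht_self n ν j t']
    have hR0 : ∀ t : Fin ν → Fin n, 0 ≤ ∑ k ∈ Finset.univ.erase j, ((t k : ℕ) : ℝ) :=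
      fun t => Finset.sum_nonneg fun k _ => Nat.cast_nonneg _
    have hR1 : ∀ t : Fin ν → Fin n, ∑ k ∈ Finset.univ.erase j, ((t k : ℕ) : ℝ)
        ≤ ((ν : ℝ) - 1) * ((n : ℝ) - 1) := by
      intro t
      have := Finset.sum_le_card_nsmul (Finset.univ.erase j) (fun k => ((t k : ℕ) : ℝ))
        ((n : ℝ) - 1) (fun k _ => hle _)
      rwa [nsmul_eq_mul, hcard] at this
    have hb := ht_bound (Nat.cast_nonneg (t j : ℕ)) (Nat.cast_nonneg (t' j : ℕ)) (hR0 t) (hR0 t')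
      (hle (t j)) (hle (t' j)) (hR1 t) (hR1 t')
    have h0 := hR0 t
    have h0' := hR0 t'
    generalize (∑ k ∈ Finset.univ.erase j, ((t k : ℕ) : ℝ)) = s at *
    generalize (∑ k ∈ Finset.univ.erase j, ((t' k : ℕ) : ℝ)) = r at *
    have hx : (0 : ℝ) ≤ ((t j : ℕ) : ℝ) := Nat.cast_nonneg _
    have hy : (0 : ℝ) ≤ ((t' j : ℕ) : ℝ) := Nat.cast_nonneg _
    generalize ((t j : ℕ) : ℝ) = x at *
    generalize ((t' j : ℕ) : ℝ) = y at *
    have e : 1 / (x + s + 1) * (1 / (y + r + 1)) / (1 / (y + s + 1) * (1 / (x + r + 1)))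
        = (y + s + 1) * (x + r + 1) / ((x + s + 1) * (y + r + 1)) := by
      have : 0 < x + s + 1 := by positivity
      have : 0 < x + r + 1 := by positivity
      have : 0 < y + s + 1 := by positivity
      have : 0 < y + r + 1 := by positivity
      field_simp
    rw [e, div_le_div_iff₀ (by positivity) (by linarith)]
    exact hb
end
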